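/- For any two subsets S₁ and S₂ of the customer set {1,…,n}, the expected traveled distance is submodular: L(S₁ ∪ S₂) ≤ L(S₁) + L(S₂) − L(S₁ ∩ S₂). -/

import Mathlib

open Finset

/-- Expected revenue of a set of customers. -/
def R (pi p : ℕ → ℝ) (S : Finset ℕ) : ℝ := ∑ i ∈ S, pi i * p i

/-- Expected traveled distance (with l i = 2 * x i). -/
def L (x pi : ℕ → ℝ) (S : Finset ℕ) : ℝ :=
  ∑ i ∈ S, (2 * x i) * pi i * ∏ j ∈ S.filter (fun j => i < j), (1 - pi j)

/-- Expected profit at unitary cost c. -/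
def G (x pi p : ℕ → ℝ) (S : Finset ℕ) (c : ℝ) : ℝ := R pi p S - c * L x pi S

/-- Optimal value of the probabilistic profitable tour problem on a line. -/
def PPTP (n : ℕ) (x pi p : ℕ → ℝ) (c : ℝ) : ℝ :=
  (Finset.Icc 1 n).powerset.sup' (Finset.powerset_nonempty _) (fun S => G x pi p S c)

theorem Finset.subset_or_eq_insert_of_subset_insert {α : Type*} [DecidableEq α] {a : α}
    {S U : Finset α} (h : S ⊆ insert a U) : S ⊆ U ∨ ∃ T ⊆ U, S = insert a T := by
  by_cases ha : a ∈ S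
  · exact Or.inr ⟨S.erase a, Finset.subset_insert_iff.mp h, (Finset.insert_erase ha).symm⟩
  · exact Or.inl ((Finset.subset_insert_iff_of_notMem ha).mp h)

/-- Conditioning on the presence of the farthest customer. -/
theorem L_insert_of_forall_lt (x pi : ℕ → ℝ) {a : ℕ} {S : Finset ℕ} (h : ∀ i ∈ S, i < a) :
    L x pi (insert a S) = 2 * x a * pi a + (1 - pi a) * L x pi S := by
  have ha : a ∉ S := fun hmem => lt_irrefl a (h a hmem)
  have hempty : (insert a S).filter (fun j => a < j) = ∅ := by
    refine Finset.filter_eq_empty_iff.mpr fun j hj => ?_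
    rcases Finset.mem_insert.mp hj with rfl | hj
    · exact lt_irrefl _
    · exact (h j hj).not_gt
  unfold L
  rw [Finset.sum_insert ha, hempty, Finset.prod_empty, mul_one, Finset.mul_sum]
  congr 1
  refine Finset.sum_congr rfl fun i hi => ?_
  rw [Finset.filter_insert, if_pos (h i hi),
    Finset.prod_insert fun hmem => ha (Finset.mem_filter.mp hmem).1]
  ring

theorem L_le_two_mul {x pi : ℕ → ℝ} {b : ℝ} (hb : 0 ≤ b) (S : Finset ℕ)
    (hxb : ∀ i ∈ S, x i ≤ b) (h0 : ∀ i ∈ S, 0 ≤ pi i) (h1 : ∀ i ∈ S, pi i ≤ 1) :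
    L x pi S ≤ 2 * b := by
  induction S using Finset.induction_on_max with
  | empty => simpa [L] using hb
  | insert a S hlt ih =>
    simp only [Finset.forall_mem_insert] at hxb h0 h1
    rw [L_insert_of_forall_lt x pi hlt]
    have hS := ih hxb.2 h0.2 h1.2
    nlinarith [mul_le_mul_of_nonneg_left hS (sub_nonneg.mpr h1.1),
      mul_le_mul_of_nonneg_right hxb.1 h0.1]

theorem L_mono {x pi : ℕ → ℝ} (B : Finset ℕ) (hx : ∀ i ∈ B, 0 ≤ x i)
    (h0 : ∀ i ∈ B, 0 ≤ pi i) (h1 : ∀ i ∈ B, pi i ≤ 1) (hmono : MonotoneOn x B)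
    {A : Finset ℕ} (hAB : A ⊆ B) : L x pi A ≤ L x pi B := by
  induction B using Finset.induction_on_max generalizing A with
  | empty => rw [Finset.subset_empty.mp hAB]
  | insert a B hlt ih =>
    have hxa : ∀ i ∈ B, x i ≤ x a := fun i hi =>
      hmono (Finset.mem_insert_of_mem hi) (Finset.mem_insert_self a B) (hlt i hi).le
    simp only [Finset.forall_mem_insert] at hx h0 h1
    have ih' := fun {A : Finset ℕ} (hA : A ⊆ B) => ih hx.2 h0.2 h1.2
      (hmono.mono (Finset.coe_subset.mpr (Finset.subset_insert a B))) hA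
    rw [L_insert_of_forall_lt x pi hlt]
    rcases Finset.subset_or_eq_insert_of_subset_insert hAB with hA | ⟨T, hT, rfl⟩
    · have hbound := L_le_two_mul hx.1 A (fun i hi => hxa i (hA hi))
        (fun i hi => h0.2 i (hA hi)) (fun i hi => h1.2 i (hA hi))
      nlinarith [mul_le_mul_of_nonneg_left (ih' hA) (sub_nonneg.mpr h1.1),
        mul_le_mul_of_nonneg_right hbound h0.1]
    · rw [L_insert_of_forall_lt x pi fun i hi => hlt i (hT hi)]
      linarith [mul_le_mul_of_nonneg_left (ih' hT) (sub_nonneg.mpr h1.1)]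

theorem L_union_add_L_inter_le {x pi : ℕ → ℝ} (U : Finset ℕ) (hx : ∀ i ∈ U, 0 ≤ x i)
    (h0 : ∀ i ∈ U, 0 ≤ pi i) (h1 : ∀ i ∈ U, pi i ≤ 1) (hmono : MonotoneOn x U)
    {A B : Finset ℕ} (hA : A ⊆ U) (hB : B ⊆ U) :
    L x pi (A ∪ B) + L x pi (A ∩ B) ≤ L x pi A + L x pi B := by
  induction U using Finset.induction_on_max generalizing A B with
  | empty => simp [Finset.subset_empty.mp hA, Finset.subset_empty.mp hB]
  | insert a U hlt ih =>
    simp only [Finset.forall_mem_insert] at hx h0 h1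
    have hmono' : MonotoneOn x U :=
      hmono.mono (Finset.coe_subset.mpr (Finset.subset_insert a U))
    have ih' := fun {A B : Finset ℕ} (hA : A ⊆ U) (hB : B ⊆ U) =>
      ih hx.2 h0.2 h1.2 hmono' hA hB
    have hrec := fun {S : Finset ℕ} (hS : S ⊆ U) =>
      L_insert_of_forall_lt x pi fun i hi => hlt i (hS hi)
    have hinter := fun {S T : Finset ℕ} (hT : T ⊆ U) (hST : S ⊆ T) =>
      mul_le_mul_of_nonneg_left
        (L_mono T (fun i hi => hx.2 i (hT hi)) (fun i hi => h0.2 i (hT hi))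
          (fun i hi => h1.2 i (hT hi)) (hmono'.mono (Finset.coe_subset.mpr hT)) hST) h0.1
    have ha : ∀ {S : Finset ℕ}, S ⊆ U → a ∉ S := fun hS hmem => lt_irrefl a (hlt a (hS hmem))
    have hstep := fun {A B : Finset ℕ} (hA : A ⊆ U) (hB : B ⊆ U) =>
      mul_le_mul_of_nonneg_left (ih' hA hB) (sub_nonneg.mpr h1.1)
    rcases Finset.subset_or_eq_insert_of_subset_insert hA with hAU | ⟨A, hAU, rfl⟩ <;>
      rcases Finset.subset_or_eq_insert_of_subset_insert hB with hBU | ⟨B, hBU, rfl⟩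
    · exact ih' hAU hBU
    · rw [Finset.union_insert, Finset.inter_insert_of_notMem (ha hAU),
        hrec (Finset.union_subset hAU hBU), hrec hBU]
      linarith [hstep hAU hBU, hinter hAU (Finset.inter_subset_left (s₂ := B))]
    · rw [Finset.insert_union, Finset.insert_inter_of_notMem (ha hBU),
        hrec (Finset.union_subset hAU hBU), hrec hAU]
      linarith [hstep hAU hBU, hinter hBU (Finset.inter_subset_right (s₁ := A))]
    · rw [← Finset.insert_union_distrib, ← Finset.insert_inter_distrib,
        hrec (Finset.union_subset hAU hBU), hrec (Finset.inter_subset_left.trans hAU),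
        hrec hAU, hrec hBU]
      linarith [hstep hAU hBU]

theorem stmt5 (n : ℕ) (x p pi : ℕ → ℝ)
    (hx : ∀ i ∈ Finset.Icc 1 n, 0 < x i)
    (hxmono : ∀ i, 1 ≤ i → i + 1 ≤ n → x i ≤ x (i + 1))
    (hp : ∀ i ∈ Finset.Icc 1 n, 0 < p i)
    (hpi : ∀ i ∈ Finset.Icc 1 n, 0 < pi i ∧ pi i ≤ 1)
    (S₁ S₂ : Finset ℕ) (hS₁ : S₁ ⊆ Finset.Icc 1 n) (hS₂ : S₂ ⊆ Finset.Icc 1 n) :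
    L x pi (S₁ ∪ S₂) ≤ L x pi S₁ + L x pi S₂ - L x pi (S₁ ∩ S₂) := by
  have hmono : MonotoneOn x (Finset.Icc 1 n : Finset ℕ) := by
    intro i hi j hj hij
    simp only [Finset.coe_Icc, Set.mem_Icc] at hi hj
    obtain ⟨hi, -⟩ := hi
    obtain ⟨-, hj⟩ := hj
    induction j, hij using Nat.le_induction with
    | base => exact le_rfl
    | succ j hij ih => exact (ih (by omega)).trans (hxmono j (by omega) hj)
  have h := L_union_add_L_inter_le (Finset.Icc 1 n) (fun i hi => (hx i hi).le)
    (fun i hi => (hpi i hi).1.le) (fun i hi => (hpi i hi).2) hmono hS₁ hS₂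
  linarith
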